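/- The numbers L_n of large (3,2)-Motzkin paths of length n satisfy L_0 = 1 and, for every integer n ≥ 1, the recurrence L_n = 2·L_{n−1} + 2·∑_{k=0}^{n−2} m_k · L_{n−2−k}, where m_k denotes the number of (3,2)-Motzkin paths of length k (the sum being empty when n = 1). (This is the coefficient form of the functional equation L(x) = 1 + 2x·L(x) + 2x²·M(x)·L(x).) -/

import Mathlib

/-- Steps of a (3,2)-Motzkin path: one up step, two colored down steps,
three colored level steps. -/
inductive MStep : Type
  | U | D1 | D2 | L1 | L2 | L3
  deriving DecidableEq

/-- Height contribution of a single step. -/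
def MStep.height : MStep → ℤ
  | .U  => 1
  | .D1 => -1
  | .D2 => -1
  | .L1 => 0
  | .L2 => 0
  | .L3 => 0

/-- Total height of a list of steps. -/
def mHeight (p : List MStep) : ℤ := (p.map MStep.height).sum

/-- A (3,2)-Motzkin path: all prefixes have nonnegative height and the
total height is 0. -/
def IsMotzkin32 (p : List MStep) : Prop :=
  (∀ q : List MStep, q <+: p → 0 ≤ mHeight q) ∧ mHeight p = 0

/-- A large (3,2)-Motzkin path: a (3,2)-Motzkin path with no `L3` level step
on the x-axis, i.e. the prefix preceding any `L3` step has positive height. -/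
def IsLargeMotzkin32 (p : List MStep) : Prop :=
  IsMotzkin32 p ∧ ∀ a b : List MStep, p = a ++ MStep.L3 :: b → 0 < mHeight a

/-- `m32 n` is the number of (3,2)-Motzkin paths of length `n`. -/
noncomputable def m32 (n : ℕ) : ℕ :=
  {p : List MStep | p.length = n ∧ IsMotzkin32 p}.ncard

/-- `L32 n` is the number of large (3,2)-Motzkin paths of length `n`. -/
noncomputable def L32 (n : ℕ) : ℕ :=
  {p : List MStep | p.length = n ∧ IsLargeMotzkin32 p}.ncard

/-- An elevated large (3,2)-Motzkin path: a large (3,2)-Motzkin path that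
touches the x-axis only at its endpoints. -/
def IsElevatedLargeMotzkin32 (p : List MStep) : Prop :=
  IsLargeMotzkin32 p ∧
    ∀ q : List MStep, q <+: p → q ≠ [] → q ≠ p → 0 < mHeight q

/-- A linked partition of `{1,…,n}`: blocks are nonempty subsets of
`{1,…,n}` covering it, and any two distinct blocks are nearly disjoint. -/
def IsLinkedPartition (n : ℕ) (π : Finset (Finset ℕ)) : Prop :=
  (∀ B ∈ π, B.Nonempty ∧ B ⊆ Finset.Icc 1 n) ∧
  (∀ i ∈ Finset.Icc 1 n, ∃ B ∈ π, i ∈ B) ∧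
  (∀ B ∈ π, ∀ B' ∈ π, B ≠ B' → ∀ k, k ∈ B → k ∈ B' →
    ((∀ j ∈ B, k ≤ j) ∧ 1 < B.card ∧ ¬ (∀ j ∈ B', k ≤ j)) ∨
    ((∀ j ∈ B', k ≤ j) ∧ 1 < B'.card ∧ ¬ (∀ j ∈ B, k ≤ j)))

/-- Noncrossing condition for a collection of blocks. -/
def IsNoncrossing (π : Finset (Finset ℕ)) : Prop :=
  ¬ ∃ B ∈ π, ∃ B' ∈ π, B ≠ B' ∧
      ∃ i₁ ∈ B, ∃ j₁ ∈ B, ∃ i₂ ∈ B', ∃ j₂ ∈ B',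
        i₁ < i₂ ∧ i₂ < j₁ ∧ j₁ < j₂

/-- `ncl n` is the number of noncrossing linked partitions of `{1,…,n}`. -/
noncomputable def ncl (n : ℕ) : ℕ :=
  {π : Finset (Finset ℕ) | IsLinkedPartition n π ∧ IsNoncrossing π}.ncard

/-- Steps of a Schröder path: up, level (width 2), down. -/
inductive SStep : Type
  | U | L | D
  deriving DecidableEq

/-- Height contribution of a Schröder step. -/
def SStep.height : SStep → ℤ
  | .U => 1
  | .L => 0
  | .D => -1

/-- Width contribution of a Schröder step. -/
def SStep.width : SStep → ℕ
  | .U => 1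
  | .L => 2
  | .D => 1

/-- Total height of a list of Schröder steps. -/
def sHeight (p : List SStep) : ℤ := (p.map SStep.height).sum

/-- Total width of a list of Schröder steps. -/
def sWidth (p : List SStep) : ℕ := (p.map SStep.width).sum

/-- A large Schröder path of length `2n`. -/
def IsLargeSchroeder (n : ℕ) (p : List SStep) : Prop :=
  sWidth p = 2 * n ∧ (∀ q : List SStep, q <+: p → 0 ≤ sHeight q) ∧
    sHeight p = 0

/-- A little Schröder path of length `2n`: a large Schröder path with no
level step on the x-axis. -/
def IsLittleSchroeder (n : ℕ) (p : List SStep) : Prop :=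
  IsLargeSchroeder n p ∧ ∀ a b : List SStep, p = a ++ SStep.L :: b → 0 < sHeight a

/-- `SchroederLarge n` is the `n`-th large Schröder number. -/
noncomputable def SchroederLarge (n : ℕ) : ℕ :=
  {p : List SStep | IsLargeSchroeder n p}.ncard

/-- `SchroederLittle n` is the `n`-th little Schröder number. -/
noncomputable def SchroederLittle (n : ℕ) : ℕ :=
  {p : List SStep | IsLittleSchroeder n p}.ncard

/-- Recursive form of the Motzkin condition, starting at height `h`. -/
def AuxW : ℤ → List MStep → Prop
  | h, [] => h = 0
  | h, s :: p => 0 ≤ h ∧ AuxW (h + s.height) p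

/-- Recursive form of the large Motzkin condition, starting at height `h`. -/
def AuxV : ℤ → List MStep → Prop
  | h, [] => h = 0
  | h, s :: p => 0 ≤ h ∧ (s = MStep.L3 → 0 < h) ∧ AuxV (h + s.height) p

lemma mHeight_nil : mHeight [] = 0 := rfl

lemma mHeight_cons (s : MStep) (p : List MStep) :
    mHeight (s :: p) = s.height + mHeight p := by
  simp [mHeight]

lemma auxW_iff (p : List MStep) : ∀ h : ℤ, AuxW h p ↔
    (∀ q : List MStep, q <+: p → 0 ≤ h + mHeight q) ∧ h + mHeight p = 0 := by
  induction p with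
  | nil =>
    intro h
    simp only [AuxW, List.prefix_nil, forall_eq, mHeight_nil]
    omega
  | cons s p ih =>
    intro h
    simp only [AuxW, ih, mHeight_cons]
    constructor
    · rintro ⟨h0, h1, h2⟩
      refine ⟨?_, by omega⟩
      intro q hq
      rcases List.prefix_cons_iff.1 hq with rfl | ⟨t, rfl, ht⟩
      · simpa [mHeight_nil] using h0
      · have := h1 t ht
        rw [mHeight_cons]; omega
    · rintro ⟨h1, h2⟩
      refine ⟨by simpa [mHeight_nil] using h1 [] List.nil_prefix, ?_, by omega⟩
      intro q hq
      have := h1 (s :: q) (List.prefix_cons_iff.2 (Or.inr ⟨q, rfl, hq⟩))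
      rw [mHeight_cons] at this; omega

lemma auxV_iff (p : List MStep) : ∀ h : ℤ, AuxV h p ↔
    AuxW h p ∧ ∀ a b : List MStep, p = a ++ MStep.L3 :: b → 0 < h + mHeight a := by
  induction p with
  | nil => intro h; simp [AuxV, AuxW]
  | cons s p ih =>
    intro h
    simp only [AuxV, AuxW, ih]
    constructor
    · rintro ⟨h0, h1, h2, h3⟩
      refine ⟨⟨h0, h2⟩, ?_⟩
      intro a b hab
      cases a with
      | nil =>
        simp only [List.nil_append, List.cons.injEq] at hab
        simpa [mHeight_nil] using h1 hab.1
      | cons t a =>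
        simp only [List.cons_append, List.cons.injEq] at hab
        obtain ⟨rfl, hab⟩ := hab
        have := h3 a b hab
        rw [mHeight_cons]; omega
    · rintro ⟨⟨h0, h1⟩, h2⟩
      refine ⟨h0, ?_, h1, ?_⟩
      · rintro rfl
        simpa [mHeight_nil] using h2 [] p rfl
      · intro a b hab
        have := h2 (s :: a) b (by simp [hab])
        rw [mHeight_cons] at this; omega

lemma motzkin_iff (p : List MStep) : IsMotzkin32 p ↔ AuxW 0 p := by
  simp [IsMotzkin32, auxW_iff]

lemma large_iff (p : List MStep) : IsLargeMotzkin32 p ↔ AuxV 0 p := by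
  simp [IsLargeMotzkin32, auxV_iff, motzkin_iff]

lemma auxW_nonneg {h : ℤ} {p : List MStep} (hp : AuxW h p) : 0 ≤ h := by
  cases p with
  | nil => simp only [AuxW] at hp; omega
  | cons s p => exact hp.1

lemma auxV_nonneg {h : ℤ} {p : List MStep} (hp : AuxV h p) : 0 ≤ h :=
  auxW_nonneg ((auxV_iff p h).1 hp).1

/-- The two down steps. -/
def dn : Bool → MStep
  | true => .D1
  | false => .D2

/-- The two level steps allowed at height zero. -/
def lv : Bool → MStep
  | true => .L1
  | false => .L2

lemma dn_height (c : Bool) : (dn c).height = -1 := by cases c <;> rfl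
lemma lv_height (c : Bool) : (lv c).height = 0 := by cases c <;> rfl
lemma dn_inj {c c' : Bool} (h : dn c = dn c') : c = c' := by
  cases c <;> cases c' <;> simp_all [dn]
lemma lv_inj {c c' : Bool} (h : lv c = lv c') : c = c' := by
  cases c <;> cases c' <;> simp_all [lv]
lemma dn_ne (c : Bool) : dn c ≠ .L3 := by cases c <;> simp [dn]
lemma lv_ne (c : Bool) : lv c ≠ .L3 := by cases c <;> simp [lv]
lemma lv_ne_U (c : Bool) : lv c ≠ .U := by cases c <;> simp [lv]

lemma auxV_join (c : Bool) (b : List MStep) (hb : AuxV 0 b) (a : List MStep) :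
    ∀ h : ℤ, AuxW h a → AuxV (h + 1) (a ++ dn c :: b) := by
  induction a with
  | nil =>
    intro h ha
    simp only [AuxW] at ha
    subst ha
    refine ⟨by norm_num, fun _ => by norm_num, ?_⟩
    rw [dn_height]
    simpa using hb
  | cons s a ih =>
    intro h ha
    have h0 := ha.1
    refine ⟨by omega, fun _ => by omega, ?_⟩
    have := ih _ ha.2
    rwa [add_right_comm] at this

lemma auxV_split (p : List MStep) : ∀ h : ℤ, 0 ≤ h → AuxV (h + 1) p →
    ∃ a c b, p = a ++ dn c :: b ∧ AuxW h a ∧ AuxV 0 b := by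
  induction p with
  | nil => intro h h0 hp; simp only [AuxV] at hp; omega
  | cons s p ih =>
    intro h h0 hp
    obtain ⟨-, -, h3⟩ := hp
    by_cases hs : 0 ≤ h + s.height
    · rw [add_right_comm] at h3
      obtain ⟨a, c, b, rfl, ha, hb⟩ := ih _ hs h3
      exact ⟨s :: a, c, b, rfl, ⟨h0, ha⟩, hb⟩
    · have key : ∃ c, s = dn c := by
        cases s
        case D1 => exact ⟨true, rfl⟩
        case D2 => exact ⟨false, rfl⟩
        all_goals simp only [MStep.height] at hs; omega
      obtain ⟨c, rfl⟩ := key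
      rw [dn_height] at hs h3
      have : h = 0 := by omega
      subst this
      exact ⟨[], c, p, rfl, rfl, by simpa using h3⟩

lemma aux_unique (c c' : Bool) (b b' : List MStep) (a : List MStep) :
    ∀ (a' : List MStep) (h : ℤ), AuxW h a → AuxW h a' →
      a ++ dn c :: b = a' ++ dn c' :: b' → a = a' ∧ c = c' ∧ b = b' := by
  induction a with
  | nil =>
    intro a' h ha ha' e
    simp only [AuxW] at ha
    cases a' with
    | nil =>
      simp only [List.nil_append, List.cons.injEq] at e
      exact ⟨rfl, dn_inj e.1, e.2⟩
    | cons s a' =>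
      simp only [List.nil_append, List.cons_append, List.cons.injEq] at e
      have := auxW_nonneg ha'.2
      rw [← e.1, dn_height] at this
      omega
  | cons s a ih =>
    intro a' h ha ha' e
    cases a' with
    | nil =>
      simp only [AuxW] at ha'
      simp only [List.nil_append, List.cons_append, List.cons.injEq] at e
      have := auxW_nonneg ha.2
      rw [e.1, dn_height] at this
      omega
    | cons s' a' =>
      simp only [List.cons_append, List.cons.injEq] at e
      obtain ⟨rfl, e⟩ := e
      obtain ⟨rfl, h2⟩ := ih a' _ ha.2 ha'.2 e
      exact ⟨rfl, h2⟩

/-- Motzkin paths of length `n`. -/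
abbrev SM (n : ℕ) : Set (List MStep) := {p | p.length = n ∧ IsMotzkin32 p}
/-- Large Motzkin paths of length `n`. -/
abbrev SL (n : ℕ) : Set (List MStep) := {p | p.length = n ∧ IsLargeMotzkin32 p}

instance : Finite MStep :=
  Finite.of_surjective
    (fun i : Fin 6 => [MStep.U, .D1, .D2, .L1, .L2, .L3].get i)
    (by
      intro s
      cases s
      exacts [⟨0, rfl⟩, ⟨1, rfl⟩, ⟨2, rfl⟩, ⟨3, rfl⟩, ⟨4, rfl⟩, ⟨5, rfl⟩])

instance (n : ℕ) : Finite (SM n) :=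
  ((List.finite_length_eq MStep n).subset (fun _ h => h.1)).to_subtype
instance (n : ℕ) : Finite (SL n) :=
  ((List.finite_length_eq MStep n).subset (fun _ h => h.1)).to_subtype

/-- Assemble a large path from its first-return decomposition. -/
def build (n : ℕ) :
    (Bool × SL n) ⊕ (Bool × (Σ k : Fin n, SM k × SL (n - 1 - k))) → List MStep
  | .inl (c, p) => lv c :: p.1
  | .inr (c, ⟨_, a, b⟩) => MStep.U :: (a.1 ++ dn c :: b.1)

lemma build_injective (n : ℕ) : Function.Injective (build n) := by
  rintro (⟨c, p, hp⟩ | ⟨c, k, ⟨a, ha⟩, ⟨b, hb⟩⟩)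
    (⟨c', p', hp'⟩ | ⟨c', k', ⟨a', ha'⟩, ⟨b', hb'⟩⟩) e
  · simp only [build, List.cons.injEq] at e
    obtain ⟨e1, rfl⟩ := e
    rw [lv_inj e1]
  · simp only [build, List.cons.injEq] at e
    exact absurd e.1 (lv_ne_U c)
  · simp only [build, List.cons.injEq] at e
    exact absurd e.1.symm (lv_ne_U c')
  · simp only [build, List.cons.injEq, true_and] at e
    obtain ⟨rfl, rfl, rfl⟩ := aux_unique c c' b b' a a' 0
      ((motzkin_iff _).1 ha.2) ((motzkin_iff _).1 ha'.2) e
    have : k = k' := Fin.ext (ha.1.symm.trans ha'.1)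
    subst this
    rfl

lemma build_range (n : ℕ) : Set.range (build n) = SL (n + 1) := by
  ext p
  constructor
  · rintro ⟨⟨c, p, hp⟩ | ⟨c, k, ⟨a, ha⟩, ⟨b, hb⟩⟩, rfl⟩
    · refine ⟨by simp [build, hp.1], (large_iff _).2 ⟨le_rfl, fun h => absurd h (lv_ne c), ?_⟩⟩
      rw [lv_height]
      simpa using (large_iff _).1 hp.2
    · refine ⟨?_, (large_iff _).2 ⟨le_rfl, fun h => by simp at h, ?_⟩⟩
      · have := k.2
        simp only [build, List.length_cons, List.length_append, ha.1, hb.1]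
        omega
      · exact auxV_join c b ((large_iff _).1 hb.2) a 0 ((motzkin_iff _).1 ha.2)
  · rintro ⟨hl, hp⟩
    rw [large_iff] at hp
    cases p with
    | nil => simp at hl
    | cons s p =>
      simp only [List.length_cons, Nat.add_right_cancel_iff] at hl
      obtain ⟨-, h1, h2⟩ := hp
      cases s with
      | U =>
        obtain ⟨a, c, b, rfl, ha, hb⟩ := auxV_split p 0 le_rfl h2
        simp only [List.length_append, List.length_cons] at hl
        exact ⟨.inr (c, ⟨⟨a.length, by omega⟩, ⟨a, rfl, (motzkin_iff _).2 ha⟩,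
          ⟨b, by simp only []; omega, (large_iff _).2 hb⟩⟩), rfl⟩
      | D1 => exact absurd (auxV_nonneg h2) (by simp [MStep.height])
      | D2 => exact absurd (auxV_nonneg h2) (by simp [MStep.height])
      | L1 => exact ⟨.inl (true, ⟨p, hl, (large_iff _).2 h2⟩), rfl⟩
      | L2 => exact ⟨.inl (false, ⟨p, hl, (large_iff _).2 h2⟩), rfl⟩
      | L3 => exact absurd (h1 rfl) (lt_irrefl _)

lemma L32_succ (n : ℕ) : L32 (n + 1) =
    2 * L32 n + 2 * ∑ k ∈ Finset.range n, m32 k * L32 (n - 1 - k) := by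
  have h : L32 (n + 1) = Nat.card (Set.range (build n)) := by
    rw [build_range]; exact (Nat.card_coe_set_eq _).symm
  have hm : ∀ k, Nat.card (SM k) = m32 k := fun k => Nat.card_coe_set_eq _
  have hL : ∀ k, Nat.card (SL k) = L32 k := fun k => Nat.card_coe_set_eq _
  rw [h, Nat.card_range_of_injective (build_injective n), Nat.card_sum, Nat.card_prod,
    Nat.card_prod, Nat.card_sigma, Finset.sum_range]
  simp only [Nat.card_prod, hm, hL, Nat.card_eq_fintype_card, Fintype.card_bool]

/-- Recurrence for the numbers of large (3,2)-Motzkin paths: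
`L 0 = 1` and `L n = 2 L (n-1) + 2 ∑_{k=0}^{n-2} m k · L (n-2-k)` for `n ≥ 1`. -/
theorem large_motzkin32_recurrence :
    L32 0 = 1 ∧ ∀ n : ℕ, 1 ≤ n →
      L32 n = 2 * L32 (n - 1) +
        2 * ∑ k ∈ Finset.range (n - 1), m32 k * L32 (n - 2 - k) := by
  refine ⟨?_, ?_⟩
  · have : {p : List MStep | p.length = 0 ∧ IsLargeMotzkin32 p} = {[]} := by
      ext p
      simp only [Set.mem_setOf_eq, List.length_eq_zero_iff, Set.mem_singleton_iff]
      constructor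
      · exact fun h => h.1
      · rintro rfl
        exact ⟨rfl, (large_iff _).2 rfl⟩
    rw [L32, this, Set.ncard_singleton]
  · intro n hn
    obtain ⟨n, rfl⟩ := Nat.exists_eq_add_of_le' hn
    have e : n + 1 - 2 = n - 1 := by omega
    rw [L32_succ, Nat.add_sub_cancel, e]
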